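/- Let μ be a complex number and n a positive even integer. Then b_n(1,0,μ) = det_{1≤i,j≤n}( −δ_{i,j−1} + C(μ+i+j−3, j−1) ) equals ( ∏_{k=0}^{n/2−1} Q3(k) ) · ( ∏_{k=1}^{n/2} Q4(k) ), where Q3(k) = 2 (μ/2+2k)_{k+1} (μ+2k+1)_{k−1} / ( (k+1)_k (μ/2+k+1)_k ) and Q4(k) = 2 (μ/2+2k−1)_{k−1} (μ+2k+1)_{k−1} / ( (k)_{k−1} (μ/2+k+1)_{k−1} ); the identity is understood after clearing all denominators (equivalently, it holds whenever all denominators are nonzero). -/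

import Mathlib

/-- Generalized binomial coefficient `C(x,k) = x(x-1)⋯(x-k+1)/k!` for complex `x`. -/
noncomputable def gbinom (x : ℂ) (k : ℕ) : ℂ :=
  (∏ i ∈ Finset.range k, (x - i)) / (k.factorial : ℂ)

/-- Pochhammer symbol `(x)_k = x(x+1)⋯(x+k-1)`. -/
noncomputable def poch (x : ℂ) (k : ℕ) : ℂ :=
  ∏ i ∈ Finset.range k, (x + i)
/-- `b_n(I,J,μ)`: determinant of the `n×n` matrix with rows indexed by
`i = I,…,n-1+I`, columns indexed by `j = J,…,n-1+J`, and entries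
`-δ_{i,j} + C(μ+i+j-2, j)`. -/
noncomputable def bdet (μ : ℂ) (n I J : ℕ) : ℂ :=
  Matrix.det (Matrix.of fun i j : Fin n =>
    (if I + i.1 = J + j.1 then (-1 : ℂ) else 0)
      + gbinom (μ + ((I + i.1 : ℕ) : ℂ) + ((J + j.1 : ℕ) : ℂ) - 2) (J + j.1))

/-- Pochhammer symbol with integer index: `(x)_k = x(x+1)⋯(x+k-1)` for `k ≥ 0`
and `(x)_{-m} = 1/((x-1)(x-2)⋯(x-m))` for `m > 0`. -/
noncomputable def pochZ (x : ℂ) (k : ℤ) : ℂ :=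
  if 0 ≤ k then ∏ i ∈ Finset.range k.toNat, (x + i)
  else (∏ i ∈ Finset.range (-k).toNat, (x - 1 - i))⁻¹

noncomputable def Q3 (μ : ℂ) (k : ℕ) : ℂ :=
  2 * poch (μ / 2 + 2 * k) (k + 1) * pochZ (μ + 2 * k + 1) ((k : ℤ) - 1)
    / (poch ((k : ℂ) + 1) k * poch (μ / 2 + k + 1) k)

noncomputable def Q4 (μ : ℂ) (k : ℕ) : ℂ :=
  2 * poch (μ / 2 + 2 * k - 1) (k - 1) * poch (μ + 2 * k + 1) (k - 1)
    / (poch (k : ℂ) (k - 1) * poch (μ / 2 + k + 1) (k - 1))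

open Matrix in
theorem det_bordered {n : ℕ} {ι : Type*} {K : Type*} [Field K] (A : Matrix ι ι K) (c : Fin n → ι)
    (h : (A.submatrix c c).det ≠ 0) (a b : ι) :
    (A.submatrix (Sum.elim c fun _ : Unit => a) (Sum.elim c fun _ : Unit => b)).det =
      (A.submatrix c c).det *
        (A a b - ∑ i, (∑ j, A a (c j) * (A.submatrix c c)⁻¹ j i) * A (c i) b) := by
  have : Invertible (A.submatrix c c) := Matrix.invertibleOfIsUnitDet _ (isUnit_iff_ne_zero.2 h)
  rw [← fromBlocks_toBlocks (A.submatrix (Sum.elim c fun _ : Unit => a) _)]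
  have e : (A.submatrix (Sum.elim c fun _ : Unit => a)
      (Sum.elim c fun _ : Unit => b)).toBlocks₁₁ = A.submatrix c c := rfl
  rw [e, det_fromBlocks₁₁, det_unique (n := Unit), invOf_eq_nonsing_inv]
  rfl

open Matrix in
theorem desnanot_jacobi {n : ℕ} {K : Type*} [Field K] (A : Matrix (Fin (n + 2)) (Fin (n + 2)) K)
    (h : (A.submatrix (fun i : Fin n => i.castSucc.succ) fun i => i.castSucc.succ).det ≠ 0) :
    A.det * (A.submatrix (fun i : Fin n => i.castSucc.succ) fun i => i.castSucc.succ).det =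
      (A.submatrix Fin.castSucc Fin.castSucc).det * (A.submatrix Fin.succ Fin.succ).det -
      (A.submatrix Fin.succ Fin.castSucc).det * (A.submatrix Fin.castSucc Fin.succ).det := by
  set c : Fin n → Fin (n + 2) := fun i => i.castSucc.succ with hc
  let e₀ : Fin n ⊕ Unit ≃ Fin (n + 1) := Equiv.ofBijective
    (Sum.elim Fin.succ fun _ => 0) <| by
      rw [Fintype.bijective_iff_surjective_and_card]
      exact ⟨fun i => Fin.cases ⟨Sum.inr (), rfl⟩ (fun j => ⟨Sum.inl j, rfl⟩) i, by simp⟩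
  let e₁ : Fin n ⊕ Unit ≃ Fin (n + 1) := Equiv.ofBijective
    (Sum.elim Fin.castSucc fun _ => Fin.last n) <| by
      rw [Fintype.bijective_iff_surjective_and_card]
      exact ⟨fun i => Fin.lastCases ⟨Sum.inr (), rfl⟩ (fun j => ⟨Sum.inl j, rfl⟩) i, by simp⟩
  let e : Fin n ⊕ (Unit ⊕ Unit) ≃ Fin (n + 2) := Equiv.ofBijective
    (Sum.elim c (Sum.elim (fun _ => 0) fun _ => Fin.last (n + 1))) <| by
      rw [Fintype.bijective_iff_surjective_and_card]
      refine ⟨fun i => ?_, by simp⟩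
      refine Fin.cases ⟨Sum.inr (Sum.inl ()), rfl⟩ (fun j => ?_) i
      exact Fin.lastCases ⟨Sum.inr (Sum.inr ()), rfl⟩ (fun k => ⟨Sum.inl k, rfl⟩) j
  let S : Fin (n + 2) → Fin (n + 2) → K := fun a b =>
    A a b - ∑ i, (∑ j, A a (c j) * (A.submatrix c c)⁻¹ j i) * A (c i) b
  have key := det_bordered A c h
  have h00 : (A.submatrix Fin.castSucc Fin.castSucc).det = (A.submatrix c c).det * S 0 0 := by
    rw [← key, ← det_submatrix_equiv_self e₀, submatrix_submatrix]
    congr 2 <;> ext x <;> rcases x with x | x <;> simp [e₀, hc]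
  have h11 : (A.submatrix Fin.succ Fin.succ).det =
      (A.submatrix c c).det * S (Fin.last _) (Fin.last _) := by
    rw [← key, ← det_submatrix_equiv_self e₁, submatrix_submatrix]
    congr 2 <;> ext x <;> rcases x with x | x <;> simp [e₁, hc]
  let σ : Equiv.Perm (Fin n ⊕ Unit) := e₁.trans e₀.symm
  have hσ : ∀ x, e₀ (σ x) = e₁ x := fun x => by simp [σ]
  have h10 : Equiv.Perm.sign σ * (A.submatrix Fin.succ Fin.castSucc).det =
      (A.submatrix c c).det * S (Fin.last _) 0 := by
    rw [← key, ← det_submatrix_equiv_self e₀, ← det_permute, submatrix_submatrix,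
      submatrix_submatrix]
    congr 2 <;> ext x
    · change ((e₀ (σ x)).succ : ℕ) = _
      rw [hσ]
      rcases x with x | x <;> simp [e₁, hc]
    · rcases x with x | x <;> simp [e₀, hc]
  have h01 : Equiv.Perm.sign σ * (A.submatrix Fin.castSucc Fin.succ).det =
      (A.submatrix c c).det * S 0 (Fin.last _) := by
    rw [← key, ← det_submatrix_equiv_self e₀, ← det_permute', submatrix_submatrix,
      submatrix_submatrix]
    congr 2 <;> ext x
    · rcases x with x | x <;> simp [e₀, hc]
    · change ((e₀ (σ x)).succ : ℕ) = _
      rw [hσ]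
      rcases x with x | x <;> simp [e₁, hc]
  have hs : ((Equiv.Perm.sign σ : ℤ) : K) * (Equiv.Perm.sign σ : ℤ) = 1 := by
    rcases Int.units_eq_one_or (Equiv.Perm.sign σ) with h | h <;> simp [h]
  have hA : A.det = (A.submatrix c c).det *
      (S 0 0 * S (Fin.last _) (Fin.last _) - S 0 (Fin.last _) * S (Fin.last _) 0) := by
    have : Invertible (A.submatrix c c) :=
      Matrix.invertibleOfIsUnitDet _ (isUnit_iff_ne_zero.2 h)
    rw [← det_submatrix_equiv_self e, ← fromBlocks_toBlocks (A.submatrix e e)]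
    have e' : (A.submatrix e e).toBlocks₁₁ = A.submatrix c c := rfl
    rw [e', det_fromBlocks₁₁, invOf_eq_nonsing_inv,
      ← det_submatrix_equiv_self (finSumFinEquiv.symm.trans
        (Equiv.sumCongr (Equiv.ofUnique (Fin 1) Unit) (Equiv.ofUnique (Fin 1) Unit))), det_fin_two]
    rfl
  rw [hA, h00, h11]
  linear_combination (-(A.submatrix Fin.succ Fin.castSucc).det *
    (A.submatrix Fin.castSucc Fin.succ).det) * hs +
    (Equiv.Perm.sign σ : ℤ) * (A.submatrix Fin.castSucc Fin.succ).det * h10 +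
    (A.submatrix c c).det * S (Fin.last _) 0 * h01

/-- The factorial of an integer, with the value `1` at negative integers. -/
noncomputable def intFact (z : ℤ) : ℂ := (z.toNat.factorial : ℂ)

/-- The reciprocal `1 / z!` of the factorial of an integer, vanishing at negative integers. -/
noncomputable def intInvFact (z : ℤ) : ℂ := if 0 ≤ z then (z.toNat.factorial : ℂ)⁻¹ else 0

theorem intFact_natCast (n : ℕ) : intFact n = n.factorial := by simp [intFact]

theorem intFact_ne_zero (z : ℤ) : intFact z ≠ 0 := by
  simp [intFact, Nat.factorial_ne_zero]

theorem intFact_add_one (z : ℤ) (hz : 0 ≤ z) : intFact (z + 1) = (z + 1) * intFact z := by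
  lift z to ℕ using hz
  have : ((z : ℤ) + 1) = ((z + 1 : ℕ) : ℤ) := by push_cast; ring
  rw [this, intFact_natCast, intFact_natCast, Nat.factorial_succ]
  push_cast
  ring

theorem intInvFact_natCast (n : ℕ) : intInvFact n = (n.factorial : ℂ)⁻¹ := by simp [intInvFact]

theorem intInvFact_of_neg {z : ℤ} (hz : z < 0) : intInvFact z = 0 := by
  simp [intInvFact, hz]

theorem intInvFact_ne_zero {z : ℤ} (hz : 0 ≤ z) : intInvFact z ≠ 0 := by
  simp [intInvFact, hz, Nat.factorial_ne_zero]

theorem intInvFact_eq (z : ℤ) : intInvFact z = (z + 1) * intInvFact (z + 1) := by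
  rcases lt_trichotomy z (-1) with h | rfl | h
  · rw [intInvFact_of_neg (by omega), intInvFact_of_neg (by omega), mul_zero]
  · simp [intInvFact_of_neg]
  · lift z to ℕ using by omega
    have : ((z : ℤ) + 1) = ((z + 1 : ℕ) : ℤ) := by push_cast; ring
    rw [this, intInvFact_natCast, intInvFact_natCast, Nat.factorial_succ]
    have := Nat.factorial_ne_zero z
    push_cast
    field_simp

/-- The matrix with entries `(x+y+i+j-1)! / ((x+2i-j)! (y+2j-i)!)`. -/
noncomputable def factMatrix (m : ℕ) (x y : ℤ) : Matrix (Fin m) (Fin m) ℂ :=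
  Matrix.of fun i j => intFact (x + y + i + j - 1) * intInvFact (x + 2 * i - j) *
    intInvFact (y + 2 * j - i)

/-- The ratio of consecutive determinants of `factMatrix`. -/
noncomputable def factTerm (i : ℕ) (x y : ℤ) : ℂ :=
  i.factorial * intFact (x + y + i - 1) * poch (2 * x + y + 2 * i) i *
    poch (x + 2 * y + 2 * i) i * intInvFact (x + 2 * i) * intInvFact (y + 2 * i)

/-- The product evaluation of the determinant of `factMatrix`. -/
noncomputable def factProd (m : ℕ) (x y : ℤ) : ℂ := ∏ i ∈ Finset.range m, factTerm i x y

theorem poch_ne_zero_of_pos {a : ℤ} (ha : 0 < a) (k : ℕ) : poch a k ≠ 0 := by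
  refine Finset.prod_ne_zero_iff.2 fun i _ => ?_
  have : (a + i : ℤ) ≠ 0 := by omega
  exact_mod_cast this

theorem factTerm_ne_zero (i : ℕ) {x y : ℤ} (hx : 0 ≤ x) (hy : 0 < y) : factTerm i x y ≠ 0 := by
  have h1 := poch_ne_zero_of_pos (a := 2 * x + y + 2 * i) (by omega) i
  have h2 := poch_ne_zero_of_pos (a := x + 2 * y + 2 * i) (by omega) i
  push_cast at h1 h2
  have h3 := intInvFact_ne_zero (z := x + 2 * i) (by omega)
  have h4 := intInvFact_ne_zero (z := y + 2 * i) (by omega)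
  have h5 := intFact_ne_zero (x + y + i - 1)
  have h6 : (i.factorial : ℂ) ≠ 0 := by exact_mod_cast i.factorial_ne_zero
  simp only [factTerm]
  positivity

theorem factTerm_shift (r : ℕ) (x y : ℤ) (hs : 1 ≤ x + y) :
    factTerm r (x + 2) (y - 1) * factTerm r (x - 1) (y + 2) *
        ((x + y + r + 1) * (x + 2 * r + 2) * (y + 2 * r + 2)) =
      factTerm r x y * factTerm r (x + 1) (y + 1) *
        ((x + y + r) * (x + 2 * r) * (y + 2 * r)) := by
  have e1 := intFact_add_one (x + y + r - 1) (by omega)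
  have e2 := intFact_add_one (x + y + r) (by omega)
  have x1 := intInvFact_eq (x + 2 * r - 1)
  have x2 := intInvFact_eq (x + 2 * r + 1)
  have y1 := intInvFact_eq (y + 2 * r - 1)
  have y2 := intInvFact_eq (y + 2 * r + 1)
  simp only [factTerm]
  push_cast
  rw [show x + 2 + (y - 1) + r - 1 = x + y + r by ring,
    show x - 1 + (y + 2) + r - 1 = x + y + r by ring,
    show x + 1 + (y + 1) + r - 1 = x + y + r + 1 by ring,
    show x + 2 + 2 * (r : ℤ) = x + 2 * r + 1 + 1 by ring,
    show x - 1 + 2 * (r : ℤ) = x + 2 * r - 1 by ring,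
    show x + 1 + 2 * (r : ℤ) = x + 2 * r + 1 by ring,
    show y + 2 + 2 * (r : ℤ) = y + 2 * r + 1 + 1 by ring,
    show y - 1 + 2 * (r : ℤ) = y + 2 * r - 1 by ring,
    show y + 1 + 2 * (r : ℤ) = y + 2 * r + 1 by ring,
    show (2 * ((x : ℂ) + 2) + (y - 1) + 2 * r) = 2 * x + y + 2 * r + 3 by ring,
    show (2 * ((x : ℂ) + 1) + (y + 1) + 2 * r) = 2 * x + y + 2 * r + 3 by ring,
    show (2 * ((x : ℂ) - 1) + (y + 2) + 2 * r) = 2 * x + y + 2 * r by ring,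
    show ((x : ℂ) + 2 + 2 * (y - 1) + 2 * r) = x + 2 * y + 2 * r by ring,
    show ((x : ℂ) + 1 + 2 * (y + 1) + 2 * r) = x + 2 * y + 2 * r + 3 by ring,
    show ((x : ℂ) - 1 + 2 * (y + 2) + 2 * r) = x + 2 * y + 2 * r + 3 by ring,
    e2, x1, y1, x2, y2, sub_add_cancel, sub_add_cancel]
  rw [sub_add_cancel] at e1
  rw [e1]
  push_cast
  ring

theorem factProd_shift (r : ℕ) (x y : ℤ) (hs : 1 ≤ x + y) :
    factProd r (x + 2) (y - 1) * factProd r (x - 1) (y + 2) *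
        ((x + y + r) * (x + 2 * r) * (y + 2 * r)) =
      factProd r x y * factProd r (x + 1) (y + 1) * ((x + y) * x * y) := by
  induction r with
  | zero => simp [factProd]
  | succ r ih =>
    have h := factTerm_shift r x y hs
    simp only [factProd, Finset.prod_range_succ] at ih ⊢
    push_cast
    linear_combination (factTerm r x y * factTerm r (x + 1) (y + 1)) * ih +
      (∏ i ∈ Finset.range r, factTerm i (x + 2) (y - 1)) *
      (∏ i ∈ Finset.range r, factTerm i (x - 1) (y + 2)) * h

theorem poch_succ_left (a : ℂ) (k : ℕ) : poch a (k + 1) = a * poch (a + 1) k := by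
  simp only [poch, Finset.prod_range_succ']
  rw [mul_comm]
  congr 1
  · simp
  · exact Finset.prod_congr rfl fun i _ => by push_cast; ring

theorem factTerm_succ (m : ℕ) (x y : ℤ) (hs : 1 ≤ x + y) :
    factTerm (m + 1) x y * ((x + y + m + 1) * (x + 2 * m + 2) * (y + 2 * m + 2)) =
      factTerm m (x + 1) (y + 1) *
        ((m + 1) * (2 * x + y + 2 * m + 2) * (x + 2 * y + 2 * m + 2)) := by
  have e2 := intFact_add_one (x + y + m) (by omega)
  have x2 := intInvFact_eq (x + 2 * m + 1)
  have y2 := intInvFact_eq (y + 2 * m + 1)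
  simp only [factTerm, poch_succ_left, Nat.factorial_succ]
  push_cast
  rw [show x + y + ((m : ℤ) + 1) - 1 = x + y + m by ring,
    show x + 1 + (y + 1) + m - 1 = x + y + m + 1 by ring,
    show x + 2 * ((m : ℤ) + 1) = x + 2 * m + 1 + 1 by ring,
    show x + 1 + 2 * (m : ℤ) = x + 2 * m + 1 by ring,
    show y + 2 * ((m : ℤ) + 1) = y + 2 * m + 1 + 1 by ring,
    show y + 1 + 2 * (m : ℤ) = y + 2 * m + 1 by ring,
    show (2 * ((x : ℂ) + 1) + (y + 1) + 2 * m) = 2 * x + y + 2 * (m + 1) + 1 by ring,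
    show ((x : ℂ) + 1 + 2 * (y + 1) + 2 * m) = x + 2 * y + 2 * (m + 1) + 1 by ring,
    e2, x2, y2]
  push_cast
  ring

theorem factProd_condensation (m : ℕ) (x y : ℤ) (hx : 0 ≤ x) (hy : 0 < y) :
    factProd (m + 2) x y * factProd m (x + 1) (y + 1) =
      factProd (m + 1) x y * factProd (m + 1) (x + 1) (y + 1) -
        factProd (m + 1) (x + 2) (y - 1) * factProd (m + 1) (x - 1) (y + 2) := by
  have h1 : ((x : ℂ) + y + m + 1) * (x + 2 * m + 2) * (y + 2 * m + 2) ≠ 0 := by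
    have : (x + y + m + 1) * (x + 2 * m + 2) * (y + 2 * m + 2) ≠ 0 := by positivity
    exact_mod_cast this
  have hS := factProd_shift (m + 1) x y (by omega)
  have hT := factTerm_succ m x y (by omega)
  apply mul_right_cancel₀ h1
  have e1 : factProd (m + 2) x y = factProd (m + 1) x y * factTerm (m + 1) x y :=
    Finset.prod_range_succ ..
  have e2 : factProd (m + 1) (x + 1) (y + 1) =
    factProd m (x + 1) (y + 1) * factTerm m (x + 1) (y + 1) := Finset.prod_range_succ ..
  push_cast at hS
  rw [e2] at hS ⊢
  rw [e1]
  linear_combination factProd (m + 1) x y * factProd m (x + 1) (y + 1) * hT + hS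

theorem det_factMatrix (m : ℕ) (x y : ℤ) (hx : -1 ≤ x) (hy : m < y) :
    (factMatrix m x y).det = factProd m x y := by
  induction m using Nat.twoStepInduction generalizing x y with
  | zero => simp [factProd]
  | one => simp [factProd, factMatrix, factTerm, poch]
  | more m ih1 ih2 =>
    push_cast at hy ih2
    rcases hx.eq_or_lt with rfl | hx
    · rw [Matrix.det_eq_zero_of_row_eq_zero 0, factProd, Finset.prod_range_succ', factTerm]
      · simp [intInvFact_of_neg]
      · intro j
        simp [factMatrix, intInvFact_of_neg (show (-1 - (j : ℤ) : ℤ) < 0 by omega)]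
    · have hne : factProd m (x + 1) (y + 1) ≠ 0 :=
        Finset.prod_ne_zero_iff.2 fun i _ => factTerm_ne_zero i (by omega) (by omega)
      have hc : (factMatrix (m + 2) x y).submatrix (fun i : Fin m => i.castSucc.succ)
          (fun i => i.castSucc.succ) = factMatrix m (x + 1) (y + 1) := by
        ext i j
        simp only [factMatrix, Matrix.submatrix_apply, Matrix.of_apply, Fin.val_succ,
          Fin.val_castSucc]
        push_cast
        refine congrArg₂ (· * ·) (congrArg₂ (· * ·) (congrArg _ ?_) (congrArg _ ?_))
          (congrArg _ ?_) <;> ring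
      have h00 : (factMatrix (m + 2) x y).submatrix Fin.castSucc Fin.castSucc =
          factMatrix (m + 1) x y := rfl
      have h11 : (factMatrix (m + 2) x y).submatrix Fin.succ Fin.succ =
          factMatrix (m + 1) (x + 1) (y + 1) := by
        ext i j
        simp only [factMatrix, Matrix.submatrix_apply, Matrix.of_apply, Fin.val_succ]
        push_cast
        refine congrArg₂ (· * ·) (congrArg₂ (· * ·) (congrArg _ ?_) (congrArg _ ?_))
          (congrArg _ ?_) <;> ring
      have h10 : (factMatrix (m + 2) x y).submatrix Fin.succ Fin.castSucc =
          factMatrix (m + 1) (x + 2) (y - 1) := by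
        ext i j
        simp only [factMatrix, Matrix.submatrix_apply, Matrix.of_apply, Fin.val_succ,
          Fin.val_castSucc]
        push_cast
        refine congrArg₂ (· * ·) (congrArg₂ (· * ·) (congrArg _ ?_) (congrArg _ ?_))
          (congrArg _ ?_) <;> ring
      have h01 : (factMatrix (m + 2) x y).submatrix Fin.castSucc Fin.succ =
          factMatrix (m + 1) (x - 1) (y + 2) := by
        ext i j
        simp only [factMatrix, Matrix.submatrix_apply, Matrix.of_apply, Fin.val_succ,
          Fin.val_castSucc]
        push_cast
        refine congrArg₂ (· * ·) (congrArg₂ (· * ·) (congrArg _ ?_) (congrArg _ ?_))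
          (congrArg _ ?_) <;> ring
      have hd := desnanot_jacobi (factMatrix (m + 2) x y)
      rw [hc, h00, h11, h10, h01, ih1 _ _ (by omega) (by omega), ih2 _ _ (by omega) (by omega),
        ih2 _ _ (by omega) (by omega), ih2 _ _ (by omega) (by omega),
        ih2 _ _ (by omega) (by omega)] at hd
      apply mul_right_cancel₀ hne
      rw [hd hne, factProd_condensation m x y (by omega) (by omega)]

theorem gbinom_natCast (N k : ℕ) : gbinom N k = N.choose k := by
  rw [gbinom, Nat.cast_choose_eq_descPochhammer_div, descPochhammer_eval_eq_prod_range]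

open PowerSeries in
theorem coeff_geom_pow (d p : ℕ) :
    coeff p ((mk 1 : ℂ⟦X⟧) ^ (d + 1)) = (d + p).choose p := by
  rw [mk_one_pow_eq_mk_choose_add, coeff_mk, Nat.choose_symm_add]

open PowerSeries in
theorem coeff_one_sub_X_pow (e p : ℕ) :
    coeff p ((1 - X : ℂ⟦X⟧) ^ e) = (-1) ^ p * e.choose p := by
  have h : (1 - X : ℂ⟦X⟧) ^ e =
      rescale (-1 : ℂ) (((1 + Polynomial.X) ^ e : Polynomial ℂ) : ℂ⟦X⟧) := by
    simp [sub_eq_add_neg]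
  rw [h, coeff_rescale, Polynomial.coeff_coe, Polynomial.coeff_one_add_X_pow]

open PowerSeries in
theorem geom_pow_mul_one_sub_X_pow (a b c : ℕ) (h : a = b + c) :
    (mk 1 : ℂ⟦X⟧) ^ a * (1 - X) ^ b = mk 1 ^ c := by
  rw [h, pow_add, mul_right_comm, ← mul_pow, mk_one_mul_one_sub_eq_one, one_pow, one_mul]

theorem choose_eq_intFact (N n k : ℕ) :
    (if k ≤ n then (N.choose (n - k) : ℂ) else 0) =
      intFact N * intInvFact (n - k) * intInvFact (N - (n - k)) := by
  split_ifs with h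
  · obtain ⟨p, rfl⟩ := Nat.exists_eq_add_of_le h
    rw [show ((k + p : ℕ) : ℤ) - k = p by push_cast; ring, Nat.add_sub_cancel_left]
    rcases le_or_gt p N with hp | hp
    · obtain ⟨q, rfl⟩ := Nat.exists_eq_add_of_le hp
      rw [show ((p + q : ℕ) : ℤ) - p = q by push_cast; ring, intFact_natCast, intInvFact_natCast,
        intInvFact_natCast, Nat.cast_add_choose]
      ring
    · rw [Nat.choose_eq_zero_of_lt hp, intInvFact_of_neg (z := N - p) (by omega)]
      simp
  · rw [intInvFact_of_neg (z := n - k) (by omega)]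
    simp

open PowerSeries in
/-- The power series whose coefficients form row `i` of the matrix of `bdet a n 1 0`. -/
noncomputable def rowSeries (a i : ℕ) : ℂ⟦X⟧ := mk 1 ^ (a + i) - X ^ (i + 1)

open PowerSeries in
theorem bdet_natCast (a n : ℕ) (ha : 1 ≤ a) :
    bdet a n 1 0 = (Matrix.of fun i j : Fin n => coeff (j : ℕ) (rowSeries a i)).det := by
  rw [bdet]
  congr 1
  ext i j
  obtain ⟨b, rfl⟩ := Nat.exists_eq_add_of_le ha
  simp only [Matrix.of_apply, rowSeries, map_sub, coeff_X_pow]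
  rw [show 1 + b + (i : ℕ) = b + i + 1 by ring, coeff_geom_pow, ← gbinom_natCast]
  rw [show ((1 + b : ℕ) : ℂ) + ((1 + (i : ℕ) : ℕ) : ℂ) + ((0 + (j : ℕ) : ℕ) : ℂ) - 2 =
    ((b + i + j : ℕ) : ℂ) by push_cast; ring, zero_add, add_comm 1 (i : ℕ)]
  by_cases h : (i : ℕ) + 1 = j
  · simp [h]; ring
  · simp [h, Ne.symm h]

/-- The monic polynomials `t ^ ⌊r/2⌋ (t-1) ^ ⌈r/2⌉` used as a basis for row operations. -/
noncomputable def rowPoly (r : ℕ) : Polynomial ℂ :=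
  Polynomial.X ^ (r / 2) * (Polynomial.X - Polynomial.C 1) ^ ((r + 1) / 2)

theorem rowPoly_monic (r : ℕ) : (rowPoly r).Monic :=
  (Polynomial.monic_X_pow _).mul ((Polynomial.monic_X_sub_C 1).pow _)

theorem natDegree_rowPoly (r : ℕ) : (rowPoly r).natDegree = r := by
  rw [rowPoly, (Polynomial.monic_X_pow _).natDegree_mul ((Polynomial.monic_X_sub_C 1).pow _),
    Polynomial.natDegree_X_pow, (Polynomial.monic_X_sub_C 1).natDegree_pow,
    Polynomial.natDegree_X_sub_C]
  omega

open PowerSeries in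
/-- The multipliers defining the column operations. -/
noncomputable def colSeries (y l : ℕ) : ℂ⟦X⟧ :=
  (1 - X) ^ (y + l / 2 - 1) * if l % 2 = 0 then 1 else 1 - C (1 / 2 : ℂ) * X

open PowerSeries in
theorem coeff_zero_colSeries (y l : ℕ) : coeff 0 (colSeries y l) = 1 := by
  unfold colSeries
  split_ifs <;> simp

open PowerSeries in
/-- The entries of the matrix of `bdet (2 * y) n 1 0` after row and column operations. -/
noncomputable def reducedEntry (y r l : ℕ) : ℂ :=
  coeff l ((mk 1 ^ (2 * y) * (mk 1 ^ (r / 2) * (mk 1 - 1) ^ ((r + 1) / 2)) -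
    X * (X ^ (r / 2) * (X - 1) ^ ((r + 1) / 2))) * colSeries y l)

open PowerSeries in
theorem sum_coeff_rowPoly_smul_rowSeries (y r n : ℕ) (hr : r < n) :
    ∑ i : Fin n, C ((rowPoly r).coeff i) * rowSeries (2 * y) i =
      mk 1 ^ (2 * y) * (mk 1 ^ (r / 2) * (mk 1 - 1) ^ ((r + 1) / 2)) -
        X * (X ^ (r / 2) * (X - 1) ^ ((r + 1) / 2)) := by
  have h (z : ℂ⟦X⟧) : z ^ (r / 2) * (z - 1) ^ ((r + 1) / 2) =
      ∑ i : Fin n, C ((rowPoly r).coeff i) * z ^ (i : ℕ) := by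
    have := Polynomial.aeval_eq_sum_range' (p := rowPoly r) (n := n)
      (by rwa [natDegree_rowPoly]) z
    rw [Finset.sum_range] at this
    simpa [rowPoly, smul_eq_C_mul] using this
  rw [h, h, Finset.mul_sum, Finset.mul_sum, ← Finset.sum_sub_distrib]
  refine Finset.sum_congr rfl fun i _ => ?_
  rw [rowSeries]
  ring

open PowerSeries in
theorem sum_coeff_mul_eq_coeff_mul (f g : ℂ⟦X⟧) {n l : ℕ} (hl : l < n) :
    ∑ j : Fin n, coeff (j : ℕ) f * (if (j : ℕ) ≤ l then coeff (l - j) g else 0) =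
      coeff l (f * g) := by
  rw [Fin.sum_univ_eq_sum_range
    (fun j => coeff j f * (if j ≤ l then coeff (l - j) g else 0)) n, coeff_mul,
    Finset.Nat.sum_antidiagonal_eq_sum_range_succ (fun i j => coeff i f * coeff j g)]
  simp only [mul_ite, mul_zero]
  rw [← Finset.sum_filter]
  refine Finset.sum_congr ?_ fun _ _ => rfl
  ext j
  simp only [Finset.mem_filter, Finset.mem_range]
  omega

open PowerSeries in
theorem bdet_eq_det_reducedEntry (y n : ℕ) (hy : 1 ≤ y) :
    bdet ((2 * y : ℕ) : ℂ) n 1 0 = (Matrix.of fun r l : Fin n => reducedEntry y r l).det := by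
  rw [bdet_natCast _ _ (by omega)]
  let L : Matrix (Fin n) (Fin n) ℂ := Matrix.of fun r i => (rowPoly r).coeff i
  let R : Matrix (Fin n) (Fin n) ℂ := Matrix.of fun j l =>
    if (j : ℕ) ≤ l then coeff ((l : ℕ) - j) (colSeries y l) else 0
  set B : Matrix (Fin n) (Fin n) ℂ :=
    Matrix.of fun i j => coeff (j : ℕ) (rowSeries (2 * y) i) with hB
  have hL : L.det = 1 := by
    rw [Matrix.det_of_isLowerTriangular]
    · refine Finset.prod_eq_one fun i _ => ?_
      have := (rowPoly_monic i).coeff_natDegree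
      rwa [natDegree_rowPoly] at this
    · intro i j hij
      refine Polynomial.coeff_eq_zero_of_natDegree_lt (p := rowPoly i) ?_
      rw [natDegree_rowPoly]
      exact hij
  have hR : R.det = 1 := by
    rw [Matrix.det_of_isUpperTriangular]
    · exact Finset.prod_eq_one fun i _ => by
        simp [R, -coeff_zero_eq_constantCoeff, coeff_zero_colSeries]
    · intro i j hij
      exact if_neg (not_le.2 hij)
  have hLBR : L * (B * R) = Matrix.of fun r l : Fin n => reducedEntry y r l := by
    ext r l
    simp only [Matrix.mul_apply, L, R, hB, Matrix.of_apply]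
    simp only [sum_coeff_mul_eq_coeff_mul _ _ l.2, ← coeff_C_mul]
    rw [← map_sum, reducedEntry, ← sum_coeff_rowPoly_smul_rowSeries y r n r.2, Finset.sum_mul]
    simp only [mul_assoc]
  rw [← hLBR, Matrix.det_mul, Matrix.det_mul, hL, hR, one_mul, mul_one]

open PowerSeries in
theorem geom_sub_one : (mk 1 - 1 : ℂ⟦X⟧) = X * mk 1 := by
  have := mk_one_mul_one_sub_eq_one ℂ
  linear_combination this

open PowerSeries in
theorem reducedEntry_even_even (y k l : ℕ) (hy : 1 ≤ y) (hl : l ≤ y) :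
    reducedEntry y (2 * k) (2 * l) =
      (y + 3 * l) * (intFact (y + l + k - 1) * intInvFact (2 * l - k) *
        intInvFact (y + 2 * k - l)) := by
  have h1 := geom_pow_mul_one_sub_X_pow (2 * y + 2 * k) (y + l - 1) (y + 2 * k - l + 1) (by omega)
  have key : (mk 1 ^ (2 * y) * (mk 1 ^ k * (mk 1 - 1) ^ k) - X * (X ^ k * (X - 1) ^ k)) *
      (1 - X : ℂ⟦X⟧) ^ (y + l - 1) =
      X ^ k * mk 1 ^ (y + 2 * k - l + 1) -
        C ((-1 : ℂ) ^ k) * (X ^ (k + 1) * (1 - X) ^ (y + l + k - 1)) := by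
    rw [geom_sub_one, ← h1, show y + l + k - 1 = k + (y + l - 1) by omega, pow_add _ k,
      ← neg_sub 1 X, neg_pow, map_pow, map_neg, map_one, mul_pow]
    ring
  rw [reducedEntry, colSeries, show 2 * k / 2 = k by omega, show (2 * k + 1) / 2 = k by omega,
    show 2 * l / 2 = l by omega, if_pos (by omega), mul_one, key, map_sub, coeff_C_mul,
    coeff_X_pow_mul', coeff_X_pow_mul', coeff_geom_pow, coeff_one_sub_X_pow]
  have e1 : (if k ≤ 2 * l then ((y + 2 * k - l + (2 * l - k)).choose (2 * l - k) : ℂ) else 0) =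
      if k ≤ 2 * l then ((y + l + k).choose (2 * l - k) : ℂ) else 0 := by
    split_ifs with h
    · congr 2; omega
    · rfl
  have e2 : (-1 : ℂ) ^ k * (if k + 1 ≤ 2 * l then (-1) ^ (2 * l - (k + 1)) *
      ((y + l + k - 1).choose (2 * l - (k + 1)) : ℂ) else 0) =
      -if k + 1 ≤ 2 * l then ((y + l + k - 1).choose (2 * l - (k + 1)) : ℂ) else 0 := by
    split_ifs with h
    · have : (-1 : ℂ) ^ k * (-1) ^ (2 * l - (k + 1)) = -1 := by
        rw [← pow_add, Odd.neg_one_pow ⟨l - 1, by omega⟩]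
      rw [← mul_assoc, this, neg_one_mul]
    · simp
  have f := intFact_add_one (y + l + k - 1) (by omega)
  have g := intInvFact_eq (2 * l - k - 1)
  rw [e1, e2, choose_eq_intFact, choose_eq_intFact]
  push_cast [Nat.cast_sub (show 1 ≤ y + l + k by omega)]
  rw [show (y : ℤ) + l + k - (2 * l - k) = y + 2 * k - l by ring,
    show (y : ℤ) + l + k - 1 - (2 * l - (k + 1)) = y + 2 * k - l by ring,
    show 2 * (l : ℤ) - (k + 1) = 2 * l - k - 1 by ring, g]
  rw [sub_add_cancel] at f ⊢
  rw [f]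
  push_cast
  ring

open PowerSeries in
theorem reducedEntry_odd_even (y k l : ℕ) (hy : 1 ≤ y) (hl : l ≤ y) :
    reducedEntry y (2 * k + 1) (2 * l) = 0 := by
  have h1 := geom_pow_mul_one_sub_X_pow (2 * y + 2 * k + 1) (y + l - 1) (y + 2 * k + 1 - l + 1)
    (by omega)
  have key : (mk 1 ^ (2 * y) * (mk 1 ^ k * (mk 1 - 1) ^ (k + 1)) -
      X * (X ^ k * (X - 1) ^ (k + 1))) * (1 - X : ℂ⟦X⟧) ^ (y + l - 1) =
      X ^ (k + 1) * (mk 1 ^ (y + 2 * k + 1 - l + 1) -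
        C ((-1 : ℂ) ^ (k + 1)) * (1 - X) ^ (y + l + k)) := by
    rw [geom_sub_one, ← h1, show y + l + k = k + 1 + (y + l - 1) by omega, pow_add _ (k + 1),
      ← neg_sub 1 X, neg_pow, map_pow, map_neg, map_one, mul_pow]
    ring
  rw [reducedEntry, colSeries, show (2 * k + 1) / 2 = k by omega,
    show (2 * k + 1 + 1) / 2 = k + 1 by omega, show 2 * l / 2 = l by omega, if_pos (by omega),
    mul_one, key, coeff_X_pow_mul', map_sub, coeff_C_mul, coeff_geom_pow, coeff_one_sub_X_pow]
  split_ifs with h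
  · have : (-1 : ℂ) ^ (k + 1) * (-1) ^ (2 * l - (k + 1)) = 1 := by
      rw [← pow_add, Even.neg_one_pow ⟨l, by omega⟩]
    rw [← mul_assoc, this, one_mul, sub_eq_zero]
    congr 2; omega
  · rfl

open PowerSeries in
theorem reducedEntry_odd_odd (y k l : ℕ) (hy : 1 ≤ y) (hl : l ≤ y) :
    reducedEntry y (2 * k + 1) (2 * l + 1) =
      (2 * (y + 1) + 3 * k) * (intFact ((y + 1) + l + k - 1) * intInvFact (2 * l - k) *
        intInvFact ((y + 1) + 2 * k - l)) := by
  have h1 := geom_pow_mul_one_sub_X_pow (2 * y + 2 * k + 1) (y + l - 1) (y + 2 * k + 1 - l + 1)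
    (by omega)
  have h2 := geom_pow_mul_one_sub_X_pow (2 * y + 2 * k + 1) (y + l) (y + 2 * k - l + 1)
    (by omega)
  have h3 : (1 - C (1 / 2 : ℂ) * X : ℂ⟦X⟧) = C (1 / 2 : ℂ) * (1 + (1 - X)) := by
    have : (C (1 / 2 : ℂ) * 2 : ℂ⟦X⟧) = 1 := by
      rw [← map_ofNat (C (R := ℂ)) 2, ← map_mul]; norm_num
    linear_combination -this
  have key : (mk 1 ^ (2 * y) * (mk 1 ^ k * (mk 1 - 1) ^ (k + 1)) -
      X * (X ^ k * (X - 1) ^ (k + 1))) * ((1 - X : ℂ⟦X⟧) ^ (y + l - 1) * (1 - C (1 / 2 : ℂ) * X)) =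
      X ^ (k + 1) * (C (1 / 2 : ℂ) * (mk 1 ^ (y + 2 * k + 1 - l + 1) + mk 1 ^ (y + 2 * k - l + 1) -
        C ((-1 : ℂ) ^ (k + 1)) * ((1 - X) ^ (y + l + k) + (1 - X) ^ (y + l + k + 1)))) := by
    rw [geom_sub_one, ← h1, ← h2, show y + l + k = k + 1 + (y + l - 1) by omega, pow_succ _ (_ + _),
      pow_add _ (k + 1), show y + l = y + l - 1 + 1 by omega, pow_succ _ (_ - 1), h3,
      Nat.add_sub_cancel,
      ← neg_sub 1 X, neg_pow, map_pow, map_neg, map_one, mul_pow]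
    ring
  rw [reducedEntry, colSeries, show (2 * k + 1) / 2 = k by omega,
    show (2 * k + 1 + 1) / 2 = k + 1 by omega, show (2 * l + 1) / 2 = l by omega,
    if_neg (by omega), key, coeff_X_pow_mul', coeff_C_mul, map_sub, coeff_C_mul, map_add, map_add,
    coeff_geom_pow, coeff_geom_pow, coeff_one_sub_X_pow, coeff_one_sub_X_pow]
  have e : (if k + 1 ≤ 2 * l + 1 then
      1 / 2 * (((y + 2 * k + 1 - l + (2 * l + 1 - (k + 1))).choose (2 * l + 1 - (k + 1)) : ℂ) +
        ((y + 2 * k - l + (2 * l + 1 - (k + 1))).choose (2 * l + 1 - (k + 1)) : ℂ) -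
        (-1) ^ (k + 1) *
        ((-1) ^ (2 * l + 1 - (k + 1)) * ((y + l + k).choose (2 * l + 1 - (k + 1)) : ℂ) +
        (-1) ^ (2 * l + 1 - (k + 1)) * ((y + l + k + 1).choose (2 * l + 1 - (k + 1)) : ℂ))) else 0) =
      (if k ≤ 2 * l then ((y + l + k + 1).choose (2 * l - k) : ℂ) else 0) +
      if k ≤ 2 * l then ((y + l + k).choose (2 * l - k) : ℂ) else 0 := by
    by_cases h : k ≤ 2 * l
    · rw [if_pos (by omega), if_pos h, if_pos h, show 2 * l + 1 - (k + 1) = 2 * l - k by omega,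
        show y + 2 * k + 1 - l + (2 * l - k) = y + l + k + 1 by omega,
        show y + 2 * k - l + (2 * l - k) = y + l + k by omega]
      have : (-1 : ℂ) ^ (k + 1) * (-1) ^ (2 * l - k) = -1 := by
        rw [← pow_add, Odd.neg_one_pow ⟨l, by omega⟩]
      linear_combination (-1 / 2 * (((y + l + k).choose (2 * l - k) : ℂ) +
        ((y + l + k + 1).choose (2 * l - k) : ℂ))) * this
    · rw [if_neg (by omega), if_neg h, if_neg h, add_zero]
  have f := intFact_add_one (y + l + k) (by omega)
  have g := intInvFact_eq (y + 2 * k - l)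
  rw [e, choose_eq_intFact, choose_eq_intFact]
  push_cast
  rw [show (y : ℤ) + l + k - (2 * l - k) = y + 2 * k - l by ring,
    show (y : ℤ) + l + k + 1 - (2 * l - k) = y + 2 * k - l + 1 by ring,
    show (y : ℤ) + 1 + l + k - 1 = y + l + k by ring,
    show (y : ℤ) + 1 + 2 * k - l = y + 2 * k - l + 1 by ring, g, f]
  push_cast
  ring

/-- The equivalence sending the two summands to the even and the odd indices. -/
noncomputable def evenOddEquiv (m : ℕ) : Fin m ⊕ Fin m ≃ Fin (2 * m) :=
  Equiv.ofBijective
    (Sum.elim (fun i => ⟨2 * i, by omega⟩) fun i => ⟨2 * i + 1, by omega⟩) <| by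
    rw [Fintype.bijective_iff_surjective_and_card]
    refine ⟨fun i => ?_, by simp; ring⟩
    rcases Nat.even_or_odd' (i : ℕ) with ⟨k, hk | hk⟩
    · exact ⟨Sum.inl ⟨k, by omega⟩, Fin.ext hk.symm⟩
    · exact ⟨Sum.inr ⟨k, by omega⟩, Fin.ext hk.symm⟩

theorem bdet_two_mul_natCast (y m : ℕ) (hy : 1 ≤ y) (hm : m ≤ y) :
    bdet ((2 * y : ℕ) : ℂ) (2 * m) 1 0 =
      ((∏ l : Fin m, ((y : ℂ) + 3 * (l : ℕ))) * (factMatrix m 0 y).det) *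
        ((∏ k : Fin m, (2 * ((y : ℂ) + 1) + 3 * (k : ℕ))) * (factMatrix m 0 (y + 1)).det) := by
  rw [bdet_eq_det_reducedEntry _ _ hy, ← Matrix.det_submatrix_equiv_self (evenOddEquiv m),
    ← Matrix.fromBlocks_toBlocks (Matrix.submatrix _ _ _)]
  have h21 : (((Matrix.of fun r l : Fin (2 * m) => reducedEntry y r l).submatrix
      (evenOddEquiv m) (evenOddEquiv m)).toBlocks₂₁) = 0 := by
    ext k l
    exact reducedEntry_odd_even y k l hy (by omega)
  rw [h21, Matrix.det_fromBlocks_zero₂₁]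
  congr 1
  · rw [← Matrix.det_transpose (factMatrix m 0 y), ← Matrix.det_mul_row]
    congr 1
    ext k l
    simp only [factMatrix, Matrix.of_apply, Matrix.transpose_apply, zero_add]
    exact reducedEntry_even_even y k l hy (by omega)
  · rw [← Matrix.det_transpose (factMatrix m 0 (y + 1)), ← Matrix.det_mul_column]
    congr 1
    ext k l
    simp only [factMatrix, Matrix.of_apply, Matrix.transpose_apply, zero_add]
    exact reducedEntry_odd_odd y k l hy (by omega)

theorem poch_succ_right (a : ℂ) (k : ℕ) : poch a (k + 1) = poch a k * (a + k) :=
  Finset.prod_range_succ ..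

theorem factorial_mul_poch (a k : ℕ) : (a.factorial : ℂ) * poch (a + 1) k = (a + k).factorial := by
  induction k with
  | zero => simp [poch]
  | succ k ih =>
    rw [poch_succ_right, ← mul_assoc, ih, ← add_assoc, Nat.factorial_succ]
    push_cast
    ring

theorem pochZ_natCast_sub_one (μ : ℂ) (k : ℕ) (hμ : μ ≠ 0) :
    (μ + 2 * k) * pochZ (μ + 2 * k + 1) ((k : ℤ) - 1) = poch (μ + 2 * k) k := by
  cases k with
  | zero => simp [pochZ, poch, hμ]
  | succ k =>
    rw [poch_succ_left]
    simp [pochZ, poch]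

theorem factTerm_mul_eq_Q3 (y k : ℕ) (hy : 0 < y) :
    ((y : ℂ) + 3 * k) * factTerm k 0 y = Q3 ((2 * y : ℕ) : ℂ) k := by
  obtain ⟨y, rfl⟩ : ∃ z, y = z + 1 := ⟨y - 1, by omega⟩
  have hp := pochZ_natCast_sub_one ((2 * (y + 1) : ℕ) : ℂ) k
    (by exact_mod_cast (by omega : 2 * (y + 1) ≠ 0))
  have h1 := factorial_mul_poch k k
  have h2 := factorial_mul_poch (y + 1 + k) k
  have n0 : ((y : ℂ) + 1 + k) ≠ 0 := by exact_mod_cast (by omega : y + 1 + k ≠ 0)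
  have n1 : poch ((k : ℂ) + 1) k ≠ 0 := by
    exact_mod_cast poch_ne_zero_of_pos (a := k + 1) (by omega) k
  have n2 : poch (((y + 1 + k : ℕ) : ℂ) + 1) k ≠ 0 := by
    exact_mod_cast poch_ne_zero_of_pos (a := (y + 1 + k : ℕ) + 1) (by omega) k
  have n3 : (k.factorial : ℂ) ≠ 0 := by exact_mod_cast k.factorial_ne_zero
  have n4 : ((y + k).factorial : ℂ) ≠ 0 := by exact_mod_cast (y + k).factorial_ne_zero
  have e1 : intFact (0 + (y + 1 : ℕ) + k - 1) = (y + k).factorial := by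
    rw [← intFact_natCast]; congr 1; push_cast; ring
  have e2 : intInvFact (0 + 2 * k) = ((k + k).factorial : ℂ)⁻¹ := by
    rw [← intInvFact_natCast]; congr 1; push_cast; ring
  have e3 : intInvFact ((y + 1 : ℕ) + 2 * k) = ((y + 1 + k + k).factorial : ℂ)⁻¹ := by
    rw [← intInvFact_natCast]; congr 1; push_cast; ring
  have e4 : ((y + 1 + k).factorial : ℂ) = (y + 1 + k) * (y + k).factorial := by
    rw [show y + 1 + k = y + k + 1 by ring, Nat.factorial_succ]; push_cast; ring
  rw [factTerm, e1, e2, e3, ← h1, ← h2, e4, Q3, poch_succ_right]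
  push_cast at hp n2 ⊢
  rw [show 2 * (0 : ℂ) + (y + 1) + 2 * k = y + 1 + 2 * k by ring,
    show (0 : ℂ) + 2 * (y + 1) + 2 * k = 2 * (y + 1) + 2 * k by ring, ← hp,
    show 2 * ((y : ℂ) + 1) / 2 = y + 1 by ring]
  field_simp
  ring

theorem factTerm_mul_eq_Q4 (y k : ℕ) :
    (2 * ((y : ℂ) + 1) + 3 * k) * factTerm k 0 (y + 1) = Q4 ((2 * y : ℕ) : ℂ) (k + 1) := by
  have h1 := factorial_mul_poch k k
  have h2 := factorial_mul_poch (y + 1 + k) k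
  have n0 : ((y : ℂ) + 1 + k) ≠ 0 := by exact_mod_cast (by omega : y + 1 + k ≠ 0)
  have n1 : poch ((k : ℂ) + 1) k ≠ 0 := by
    exact_mod_cast poch_ne_zero_of_pos (a := k + 1) (by omega) k
  have n2 : poch (((y + 1 + k : ℕ) : ℂ) + 1) k ≠ 0 := by
    exact_mod_cast poch_ne_zero_of_pos (a := (y + 1 + k : ℕ) + 1) (by omega) k
  have n3 : (k.factorial : ℂ) ≠ 0 := by exact_mod_cast k.factorial_ne_zero
  have n4 : ((y + k).factorial : ℂ) ≠ 0 := by exact_mod_cast (y + k).factorial_ne_zero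
  have e1 : intFact (0 + (y + 1) + k - 1) = (y + k).factorial := by
    rw [← intFact_natCast]; congr 1; push_cast; ring
  have e2 : intInvFact (0 + 2 * k) = ((k + k).factorial : ℂ)⁻¹ := by
    rw [← intInvFact_natCast]; congr 1; push_cast; ring
  have e3 : intInvFact (y + 1 + 2 * k) = ((y + 1 + k + k).factorial : ℂ)⁻¹ := by
    rw [← intInvFact_natCast]; congr 1; push_cast; ring
  have e4 : ((y + 1 + k).factorial : ℂ) = (y + 1 + k) * (y + k).factorial := by
    rw [show y + 1 + k = y + k + 1 by ring, Nat.factorial_succ]; push_cast; ring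
  have hp : poch (2 * (y + 1 + k)) k * (2 * (y + 1) + 3 * k) =
      2 * (y + 1 + k) * poch (2 * (y + 1 + k) + 1) k := by
    rw [← poch_succ_left, poch_succ_right]; ring
  rw [factTerm, e1, e2, e3, ← h1, ← h2, e4, Q4, Nat.add_sub_cancel]
  push_cast at n2 ⊢
  rw [show 2 * (0 : ℂ) + (y + 1) + 2 * k = y + 1 + 2 * k by ring,
    show (0 : ℂ) + 2 * (y + 1) + 2 * k = 2 * (y + 1 + k) by ring,
    show 2 * (y : ℂ) / 2 + 2 * (k + 1) - 1 = y + 1 + 2 * k by ring,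
    show 2 * (y : ℂ) + 2 * (k + 1) + 1 = 2 * (y + 1 + k) + 1 by ring,
    show 2 * (y : ℂ) / 2 + (k + 1) + 1 = y + 1 + k + 1 by ring]
  field_simp
  linear_combination poch (y + 1 + 2 * k) k * hp

theorem bdet_two_mul_natCast_eq_prod (y m : ℕ) (hm : m < y) :
    bdet ((2 * y : ℕ) : ℂ) (2 * m) 1 0 =
      (∏ k ∈ Finset.range m, Q3 ((2 * y : ℕ) : ℂ) k) *
        ∏ k ∈ Finset.Icc 1 m, Q4 ((2 * y : ℕ) : ℂ) k := by
  rw [bdet_two_mul_natCast y m (by omega) hm.le, det_factMatrix _ _ _ (by omega) (by omega),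
    det_factMatrix _ _ _ (by omega) (by omega), factProd, factProd,
    Fin.prod_univ_eq_prod_range (fun l : ℕ => (y : ℂ) + 3 * (l : ℂ)) m,
    Fin.prod_univ_eq_prod_range (fun l : ℕ => 2 * ((y : ℂ) + 1) + 3 * (l : ℂ)) m,
    ← Finset.prod_mul_distrib, ← Finset.prod_mul_distrib]
  congr 1
  · exact Finset.prod_congr rfl fun k _ => factTerm_mul_eq_Q3 y k (by omega)
  · rw [← Finset.Ico_add_one_right_eq_Icc, Finset.prod_Ico_eq_prod_range, Nat.add_sub_cancel]
    exact Finset.prod_congr rfl fun k _ => by rw [add_comm 1 k, factTerm_mul_eq_Q4]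

/-- A function `ℂ → ℂ` is polynomial if it is the evaluation of some polynomial. -/
def IsPolynomialFun (f : ℂ → ℂ) : Prop := ∃ p : Polynomial ℂ, ∀ x, f x = p.eval x

namespace IsPolynomialFun

theorem const (c : ℂ) : IsPolynomialFun fun _ => c := ⟨Polynomial.C c, by simp⟩

theorem id : IsPolynomialFun fun x => x := ⟨Polynomial.X, by simp⟩

theorem add {f g : ℂ → ℂ} (hf : IsPolynomialFun f) (hg : IsPolynomialFun g) :
    IsPolynomialFun fun x => f x + g x :=
  let ⟨p, hp⟩ := hf
  let ⟨q, hq⟩ := hg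
  ⟨p + q, by simp [hp, hq]⟩

theorem mul {f g : ℂ → ℂ} (hf : IsPolynomialFun f) (hg : IsPolynomialFun g) :
    IsPolynomialFun fun x => f x * g x :=
  let ⟨p, hp⟩ := hf
  let ⟨q, hq⟩ := hg
  ⟨p * q, by simp [hp, hq]⟩

theorem prod {ι : Type*} (s : Finset ι) {f : ι → ℂ → ℂ} (hf : ∀ i, IsPolynomialFun (f i)) :
    IsPolynomialFun fun x => ∏ i ∈ s, f i x := by
  choose p hp using hf
  exact ⟨∏ i ∈ s, p i, fun x => by simp [hp, Polynomial.eval_prod]⟩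

theorem det {n : ℕ} {M : ℂ → Matrix (Fin n) (Fin n) ℂ}
    (hM : ∀ i j, IsPolynomialFun fun x => M x i j) : IsPolynomialFun fun x => (M x).det := by
  choose p hp using hM
  refine ⟨(Matrix.of p).det, fun x => ?_⟩
  rw [← Polynomial.coe_evalRingHom, RingHom.map_det]
  exact congrArg Matrix.det (Matrix.ext fun i j => by simp [hp])

theorem poch {f : ℂ → ℂ} (hf : IsPolynomialFun f) (k : ℕ) :
    IsPolynomialFun fun x => poch (f x) k :=
  prod _ fun i => hf.add (const i)

theorem eq_of_forall_natCast {f g : ℂ → ℂ} (hf : IsPolynomialFun f) (hg : IsPolynomialFun g)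
    (N : ℕ) (h : ∀ y : ℕ, N < y → f ((2 * y : ℕ) : ℂ) = g ((2 * y : ℕ) : ℂ)) : f = g := by
  obtain ⟨p, hp⟩ := hf
  obtain ⟨q, hq⟩ := hg
  have hpq : p = q := by
    refine Polynomial.eq_of_infinite_eval_eq p q ?_
    refine Set.infinite_of_injective_forall_mem
      (f := fun y : ℕ => ((2 * (N + 1 + y) : ℕ) : ℂ)) (fun a b hab => ?_) fun y => ?_
    · have hab' : ((2 * (N + 1 + a) : ℕ) : ℂ) = ((2 * (N + 1 + b) : ℕ) : ℂ) := hab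
      have := Nat.cast_injective hab'
      omega
    · change p.eval _ = q.eval _
      rw [← hp, ← hq]
      exact h _ (by omega)
  ext x
  rw [hp, hq, hpq]

end IsPolynomialFun

theorem isPolynomialFun_bdet (n I J : ℕ) : IsPolynomialFun fun μ => bdet μ n I J := by
  refine IsPolynomialFun.det fun i j => ?_
  refine (IsPolynomialFun.const _).add ?_
  simp only [gbinom, div_eq_mul_inv, sub_eq_add_neg, add_assoc]
  exact (IsPolynomialFun.prod _ fun k => IsPolynomialFun.id.add (.const _)).mul (.const _)

/-- The numerator of `Q3`, with the factor `μ` cancelled at `k = 0`. -/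
noncomputable def Q3num (μ : ℂ) (k : ℕ) : ℂ :=
  if k = 0 then 1 else 2 * poch (μ / 2 + 2 * k) (k + 1) * poch (μ + 2 * k + 1) (k - 1)

theorem Q3_eq_div (μ : ℂ) (k : ℕ) (hμ : μ ≠ 0) :
    Q3 μ k = Q3num μ k / (poch ((k : ℂ) + 1) k * poch (μ / 2 + k + 1) k) := by
  rw [Q3, Q3num]
  cases k with
  | zero =>
    simp [pochZ, poch]
    field_simp
  | succ k => simp [pochZ, poch]

theorem isPolynomialFun_Q3num (k : ℕ) : IsPolynomialFun fun μ => Q3num μ k := by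
  unfold Q3num
  split_ifs
  · exact .const 1
  · simp only [div_eq_mul_inv, add_assoc]
    exact ((IsPolynomialFun.const 2).mul
      (((IsPolynomialFun.id.mul (.const _)).add (.const _)).poch _)).mul
      ((IsPolynomialFun.id.add (.const _)).poch _)

theorem isPolynomialFun_Q3den (k : ℕ) :
    IsPolynomialFun fun μ => poch ((k : ℂ) + 1) k * poch (μ / 2 + k + 1) k := by
  simp only [div_eq_mul_inv, add_assoc]
  exact (IsPolynomialFun.const _).mul (((IsPolynomialFun.id.mul (.const _)).add (.const _)).poch _)

theorem isPolynomialFun_Q4num (k : ℕ) : IsPolynomialFun fun μ =>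
    2 * poch (μ / 2 + 2 * k - 1) (k - 1) * poch (μ + 2 * k + 1) (k - 1) := by
  simp only [div_eq_mul_inv, sub_eq_add_neg, add_assoc]
  exact ((IsPolynomialFun.const 2).mul
    (((IsPolynomialFun.id.mul (.const _)).add (.const _)).poch _)).mul
    ((IsPolynomialFun.id.add (.const _)).poch _)

theorem isPolynomialFun_Q4den (k : ℕ) :
    IsPolynomialFun fun μ => poch (k : ℂ) (k - 1) * poch (μ / 2 + k + 1) (k - 1) := by
  simp only [div_eq_mul_inv, add_assoc]
  exact (IsPolynomialFun.const _).mul (((IsPolynomialFun.id.mul (.const _)).add (.const _)).poch _)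

theorem bdet_mul_eq (m : ℕ) (μ : ℂ) :
    bdet μ (2 * m) 1 0 *
        ((∏ k ∈ Finset.range m, (poch ((k : ℂ) + 1) k * poch (μ / 2 + k + 1) k)) *
          ∏ k ∈ Finset.Icc 1 m, (poch (k : ℂ) (k - 1) * poch (μ / 2 + k + 1) (k - 1))) =
      (∏ k ∈ Finset.range m, Q3num μ k) * ∏ k ∈ Finset.Icc 1 m,
        (2 * poch (μ / 2 + 2 * k - 1) (k - 1) * poch (μ + 2 * k + 1) (k - 1)) := by
  refine congrFun (IsPolynomialFun.eq_of_forall_natCast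
    ((isPolynomialFun_bdet (2 * m) 1 0).mul ((IsPolynomialFun.prod _ isPolynomialFun_Q3den).mul
      (IsPolynomialFun.prod _ isPolynomialFun_Q4den)))
    ((IsPolynomialFun.prod _ isPolynomialFun_Q3num).mul
      (IsPolynomialFun.prod _ isPolynomialFun_Q4num)) m fun y hy => ?_) μ
  have hpos (k j : ℕ) : poch (((2 * y : ℕ) : ℂ) / 2 + k + 1) j ≠ 0 := by
    have := poch_ne_zero_of_pos (a := y + k + 1) (by omega) j
    push_cast at this ⊢
    rwa [mul_div_cancel_left₀ _ two_ne_zero]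
  have h3 (k : ℕ) : poch ((k : ℂ) + 1) k ≠ 0 := by
    exact_mod_cast poch_ne_zero_of_pos (a := k + 1) (by omega) k
  have h4 (k : ℕ) (hk : 1 ≤ k) : poch (k : ℂ) (k - 1) ≠ 0 := by
    exact_mod_cast poch_ne_zero_of_pos (a := k) (by omega) (k - 1)
  have hy0 : ((2 * y : ℕ) : ℂ) ≠ 0 := by
    exact_mod_cast (by omega : 2 * y ≠ 0)
  rw [bdet_two_mul_natCast_eq_prod y m hy, mul_mul_mul_comm, ← Finset.prod_mul_distrib,
    ← Finset.prod_mul_distrib]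
  congr 1
  · exact Finset.prod_congr rfl fun k _ => by
      rw [Q3_eq_div _ _ hy0, div_mul_cancel₀ _ (mul_ne_zero (h3 k) (hpos k k))]
  · exact Finset.prod_congr rfl fun k hk => by
      rw [Q4, div_mul_cancel₀ _ (mul_ne_zero (h4 k (Finset.mem_Icc.1 hk).1) (hpos k _))]

/-- Theorem (b10), even case: the determinant `b_n(1,0,μ)`, whenever all
denominators occurring in `Q3`, `Q4` are nonzero (the factor
`(μ+1)_{0-1} = 1/μ` in `Q3(0)` contributes the denominator `μ`). -/
theorem b10_even (μ : ℂ) (n : ℕ) (hn : 0 < n) (hne : Even n)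
    (hμ : μ ≠ 0)
    (h3 : ∀ k ∈ Finset.range (n / 2),
      poch ((k : ℂ) + 1) k * poch (μ / 2 + k + 1) k ≠ 0)
    (h4 : ∀ k ∈ Finset.Icc 1 (n / 2),
      poch (k : ℂ) (k - 1) * poch (μ / 2 + k + 1) (k - 1) ≠ 0) :
    bdet μ n 1 0
      = (∏ k ∈ Finset.range (n / 2), Q3 μ k) * ∏ k ∈ Finset.Icc 1 (n / 2), Q4 μ k := by
  simp only [Q3_eq_div _ _ hμ, Q4, Finset.prod_div_distrib]
  rw [div_mul_div_comm, eq_div_iff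
    (mul_ne_zero (Finset.prod_ne_zero_iff.2 h3) (Finset.prod_ne_zero_iff.2 h4)), ← bdet_mul_eq,
    Nat.two_mul_div_two_of_even hne]
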